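/- Suppose the continuous path ζ : [0,∞) → Σ satisfies condition (A), that S = 𝒮(ζ_0) is r-absorbing, and let T = inf{t ≥ 0 : ζ_t(i) = 0 for some i ∈ S} (with T = ∞ if no such t exists). Then ζ_t(j) = 0 for every j ∈ V∖S and every t ∈ [0,T). -/

import Mathlib

open Finset

section ZRP

variable {V : Type*} [Fintype V] [DecidableEq V]

/-- Irreducibility of a set of transition rates. -/
def IrreducibleRates (r : V → V → ℝ) : Prop :=
  ∀ i j : V, i ≠ j → ∃ (m : ℕ) (k : ℕ → V), k 0 = i ∧ k m = j ∧ ∀ l < m, 0 < r (k l) (k (l + 1))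

/-- `ind A j` plays the role of the vector `1^A_j`: it equals the indicator of `{j}` on `A`
and is harmonic (for the generator of `r`) at every point outside `A`. -/
def IsHarmFamily (r : V → V → ℝ) (ind : Finset V → V → V → ℝ) : Prop :=
  ∀ (A : Finset V), ∀ j ∈ A,
    (∀ i ∈ A, ind A j i = if i = j then (1 : ℝ) else 0) ∧
    (∀ k, k ∉ A → ∑ l, r k l * (ind A j l - ind A j k) = 0)

/-- The trace rates `r^A(i,j) = r(i,j) + ∑_{k∉A} r(i,k)·1^A_j(k)` (for `i ≠ j`). -/
noncomputable def traceRate (r : V → V → ℝ) (ind : Finset V → V → V → ℝ)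
    (A : Finset V) (i j : V) : ℝ :=
  if i = j then 0 else r i j + ∑ k ∈ Aᶜ, r i k * ind A j k

/-- `λ^A(i) = ∑_{j∈A} (r^A(j,i) − r^A(i,j))`. -/
noncomputable def lamA (r : V → V → ℝ) (ind : Finset V → V → V → ℝ)
    (A : Finset V) (i : V) : ℝ :=
  ∑ j ∈ A, (traceRate r ind A j i - traceRate r ind A i j)

/-- `A` is `r`-absorbing if `A = V` or `λ^{A∪{j}}(j) ≤ 0` for every `j ∉ A`. -/
def IsAbsorbing (r : V → V → ℝ) (ind : Finset V → V → V → ℝ) (A : Finset V) : Prop :=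
  A = Finset.univ ∨ ∀ j ∉ A, lamA r ind (insert j A) j ≤ 0

/-- The support `𝒮(u) = {i : u i > 0}`. -/
noncomputable def suppF (u : V → ℝ) : Finset V :=
  open scoped Classical in Finset.univ.filter (fun i => 0 < u i)

/-- `𝒜(S)`: the intersection of all `r`-absorbing subsets of `V` containing `S`. -/
noncomputable def minAbs (r : V → V → ℝ) (ind : Finset V → V → V → ℝ) (S : Finset V) :
    Finset V :=
  open scoped Classical in
  Finset.univ.filter (fun i => ∀ A : Finset V, IsAbsorbing r ind A → S ⊆ A → i ∈ A)

/-- The vector `v_i = ∑_k r(i,k)(1_{k} − 1_{i})`. -/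
noncomputable def vvec (r : V → V → ℝ) (i : V) : V → ℝ :=
  fun l => ∑ k, r i k * ((if l = k then (1 : ℝ) else 0) - (if l = i then (1 : ℝ) else 0))

/-- The vector `λ(j) = ∑_i (r(i,j) − r(j,i))`. -/
noncomputable def lamV (r : V → V → ℝ) : V → ℝ := fun j => ∑ i, (r i j - r j i)

/-- Membership in `D_B`: `f` is `C¹` on an open set containing the simplex and
`⟨∇f(u), v_i⟩ = 0` whenever `u ∈ Σ`, `u i = 0`, for every `i ∈ B`. -/
def MemD (r : V → V → ℝ) (B : Finset V) (f : (V → ℝ) → ℝ) : Prop :=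
  (∃ U : Set (V → ℝ), IsOpen U ∧ stdSimplex ℝ V ⊆ U ∧ ContDiffOn ℝ 1 f U) ∧
  ∀ i ∈ B, ∀ u ∈ stdSimplex ℝ V, u i = 0 → fderiv ℝ f u (vvec r i) = 0

/-- Condition (A). -/
def CondA (r : V → V → ℝ) (ζ : ℝ → V → ℝ) : Prop :=
  ∀ f : (V → ℝ) → ℝ, MemD r Finset.univ f → ∀ t : ℝ, 0 ≤ t →
    f (ζ t) = f (ζ 0) + ∫ s in (0:ℝ)..t, fderiv ℝ f (ζ s) (lamV r)

/-- A continuous path in the simplex (for nonnegative times). -/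
def IsPath (ζ : ℝ → V → ℝ) : Prop :=
  ContinuousOn ζ (Set.Ici 0) ∧ ∀ t : ℝ, 0 ≤ t → ζ t ∈ stdSimplex ℝ V

/-- `Σ_abs`: the configurations whose support is `r`-absorbing. -/
def SigmaAbs (r : V → V → ℝ) (ind : Finset V → V → V → ℝ) : Set (V → ℝ) :=
  {u | u ∈ stdSimplex ℝ V ∧ IsAbsorbing r ind (suppF u)}

/-- Condition (B): `inf{t ≥ 0 : ζ_t ∈ Σ_abs} = 0`. -/
def CondB (r : V → V → ℝ) (ind : Finset V → V → V → ℝ) (ζ : ℝ → V → ℝ) : Prop :=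
  ∀ ε : ℝ, 0 < ε → ∃ t : ℝ, 0 ≤ t ∧ t < ε ∧ ζ t ∈ SigmaAbs r ind

end ZRP

/-- The generator `Lw(i) = ∑_k r(i,k)(w(k) − w(i))`. -/
noncomputable def markovGen {V : Type*} [Fintype V] (r : V → V → ℝ) (w : V → ℝ) (i : V) : ℝ :=
  ∑ k, r i k * (w k - w i)

/-- The `C¹` function `z ↦ (z⁺)²`. -/
noncomputable def posSq (z : ℝ) : ℝ := (max z 0) ^ 2

section PosSq

lemma posSq_nonneg (z : ℝ) : 0 ≤ posSq z := sq_nonneg _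

lemma posSq_of_nonpos {z : ℝ} (hz : z ≤ 0) : posSq z = 0 := by
  simp [posSq, max_eq_right hz]

lemma hasDerivAt_posSq (z : ℝ) : HasDerivAt posSq (2 * max z 0) z := by
  rcases lt_trichotomy z 0 with hz | rfl | hz
  · rw [max_eq_right hz.le, mul_zero]
    refine (hasDerivAt_const z (0 : ℝ)).congr_of_eventuallyEq ?_
    filter_upwards [gt_mem_nhds hz] with x hx
    exact posSq_of_nonpos hx.le
  · rw [max_self, mul_zero, hasDerivAt_iff_isLittleO]
    have h : (fun x : ℝ => x ^ 2) =o[nhds 0] fun x : ℝ => x :=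
      Asymptotics.isLittleO_pow_id one_lt_two
    refine (Asymptotics.IsBigO.of_bound 1 ?_).trans_isLittleO (h.congr_right fun x => ?_)
    · refine Filter.Eventually.of_forall fun x => ?_
      have : |max x 0| ≤ |x| := by
        rcases le_total x 0 with hx | hx
        · simp [max_eq_right hx]
        · simp [max_eq_left hx]
      simpa [posSq] using sq_le_sq.2 this
    · simp
  · rw [max_eq_left hz.le]
    have h : HasDerivAt (fun x : ℝ => x ^ 2) (2 * z) z := by
      simpa using hasDerivAt_pow 2 z
    refine h.congr_of_eventuallyEq ?_
    filter_upwards [lt_mem_nhds hz] with x hx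
    simp [posSq, max_eq_left hx.le]

lemma contDiff_posSq : ContDiff ℝ 1 posSq := by
  rw [contDiff_one_iff_deriv]
  refine ⟨fun z => (hasDerivAt_posSq z).differentiableAt, ?_⟩
  have : deriv posSq = fun z => 2 * max z 0 := funext fun z => (hasDerivAt_posSq z).deriv
  rw [this]
  fun_prop

lemma lt_one_of_posSq_lt_one {z : ℝ} (h : posSq z < 1) : z < 1 := by
  by_contra! hz
  have : posSq z = z ^ 2 := by rw [posSq, max_eq_left (by linarith)]
  nlinarith

lemma nonpos_of_posSq_nonpos {z : ℝ} (h : posSq z ≤ 0) : z ≤ 0 := by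
  have : max z 0 = 0 := pow_eq_zero_iff two_ne_zero |>.1 (le_antisymm h (posSq_nonneg z))
  exact max_eq_right_iff.1 this

end PosSq

section Plateau

variable {V : Type*} [Fintype V]

/-- The test function `u ↦ −((1 − ∑_v ((α_v + β_v ⟨u, G(·,v)⟩)⁺)²)⁺)²`. -/
noncomputable def plateau (α β : V → ℝ) (G : V → V → ℝ) (u : V → ℝ) : ℝ :=
  -posSq (1 - ∑ v, posSq (α v + β v * ∑ k, u k * G k v))

lemma contDiff_plateau (α β : V → ℝ) (G : V → V → ℝ) : ContDiff ℝ 1 (plateau α β G) := by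
  unfold plateau
  refine (contDiff_posSq.comp (contDiff_const.sub (ContDiff.sum fun v _ =>
    contDiff_posSq.comp ?_))).neg
  fun_prop

lemma fderiv_plateau (α β : V → ℝ) (G : V → V → ℝ) (u h : V → ℝ) :
    fderiv ℝ (plateau α β G) u h =
      2 * max (1 - ∑ v, posSq (α v + β v * ∑ k, u k * G k v)) 0 *
        ∑ v, 2 * max (α v + β v * ∑ k, u k * G k v) 0 * (β v * ∑ k, h k * G k v) := by
  have hd : DifferentiableAt ℝ (plateau α β G) u :=
    (contDiff_plateau α β G).differentiable one_ne_zero u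
  have hlin : ∀ v, HasDerivAt (fun x : ℝ => α v + β v * ∑ k, (u + x • h) k * G k v)
      (β v * ∑ k, h k * G k v) 0 := by
    intro v
    have hk : ∀ k ∈ (univ : Finset V),
        HasDerivAt (fun x : ℝ => (u + x • h) k * G k v) (h k * G k v) 0 := by
      intro k _
      have := (((hasDerivAt_id (0 : ℝ)).mul_const (h k)).const_add (u k)).mul_const (G k v)
      simpa using this
    exact ((HasDerivAt.fun_sum hk).const_mul (β v)).const_add (α v)
  have hin : ∀ v ∈ (univ : Finset V),
      HasDerivAt (fun x : ℝ => posSq (α v + β v * ∑ k, (u + x • h) k * G k v))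
        (2 * max (α v + β v * ∑ k, u k * G k v) 0 * (β v * ∑ k, h k * G k v)) 0 := by
    intro v _
    have := (hasDerivAt_posSq (α v + β v * ∑ k, (u + (0 : ℝ) • h) k * G k v)).comp 0 (hlin v)
    simpa [Function.comp_def] using this
  have hout := (((hasDerivAt_posSq
    (1 - ∑ v, posSq (α v + β v * ∑ k, (u + (0 : ℝ) • h) k * G k v))).comp 0
      ((HasDerivAt.fun_sum hin).const_sub 1))).neg
  have hline : HasDerivAt (fun x : ℝ => plateau α β G (u + x • h))
      (fderiv ℝ (plateau α β G) u h) 0 := hd.hasFDerivAt.hasLineDerivAt h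
  rw [hline.unique hout]
  simp

end Plateau

section Generator

variable {V : Type*} [Fintype V] {r : V → V → ℝ}

lemma sum_lamV_mul (r : V → V → ℝ) (w : V → ℝ) :
    ∑ j, lamV r j * w j = ∑ i, markovGen r w i := by
  simp only [lamV, markovGen, Finset.sum_mul, sub_mul, mul_sub, Finset.sum_sub_distrib]
  rw [Finset.sum_comm]

/-- Minimum principle: a function that is nonnegative on a nonempty set `A` and superharmonic
off `A` is nonnegative. -/
lemma nonneg_of_superharmonic (hr : ∀ i j, 0 ≤ r i j) (hirr : IrreducibleRates r)
    {A : Finset V} (hA : A.Nonempty) {w : V → ℝ} (hw : ∀ i ∈ A, 0 ≤ w i)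
    (hL : ∀ i, i ∉ A → markovGen r w i ≤ 0) (i : V) : 0 ≤ w i := by
  obtain ⟨a, ha⟩ := hA
  obtain ⟨k₀, -, hk₀⟩ := Finset.exists_min_image univ w ⟨a, mem_univ a⟩
  refine le_trans ?_ (hk₀ i (mem_univ i))
  by_contra! hneg
  have hnot : ∀ k, w k = w k₀ → k ∉ A := fun k hk hkA => by
    have := hw k hkA
    linarith
  obtain ⟨m, p, hp0, hpm, hp⟩ := hirr k₀ a (fun h => hnot k₀ rfl (h ▸ ha))
  have hmin : ∀ l ≤ m, w (p l) = w k₀ := by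
    intro l
    induction l with
    | zero => intro _; rw [hp0]
    | succ l ih =>
      intro hl
      have hwl := ih (by omega)
      have hterm : ∀ k ∈ univ, 0 ≤ r (p l) k * (w k - w (p l)) := fun k _ =>
        mul_nonneg (hr _ _) (by linarith [hk₀ k (mem_univ k)])
      have hzero := (Finset.sum_eq_zero_iff_of_nonneg hterm).1
        (le_antisymm (hL _ (hnot _ hwl)) (Finset.sum_nonneg hterm)) (p (l + 1)) (mem_univ _)
      rcases mul_eq_zero.1 hzero with h | h
      · exact absurd h (hp l (by omega)).ne'
      · linarith
  exact hnot _ (hmin m le_rfl) (hpm ▸ ha)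

lemma markovGen_sub_smul (r : V → V → ℝ) (w g : V → ℝ) (c : ℝ) (i : V) :
    markovGen r (fun k => w k - c * g k) i = markovGen r w i - c * markovGen r g i := by
  simp only [markovGen, Finset.mul_sum, ← Finset.sum_sub_distrib]
  exact Finset.sum_congr rfl fun k _ => by ring

lemma eq_zero_of_harmonic (hr : ∀ i j, 0 ≤ r i j) (hirr : IrreducibleRates r)
    {A : Finset V} (hA : A.Nonempty) {w : V → ℝ} (hw : ∀ i ∈ A, w i = 0)
    (hL : ∀ i, i ∉ A → markovGen r w i = 0) (i : V) : w i = 0 := by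
  refine le_antisymm ?_
    (nonneg_of_superharmonic hr hirr hA (fun i hi => (hw i hi).ge) (fun i hi => (hL i hi).le) i)
  have h := nonneg_of_superharmonic hr hirr hA (w := fun k => 0 - 1 * w k)
    (fun i hi => by simp [hw i hi])
    (fun i hi => by
      rw [markovGen_sub_smul r (fun _ => 0) w 1, hL i hi]
      simp [markovGen]) i
  linarith

variable [DecidableEq V]

lemma sum_vvec_mul (r : V → V → ℝ) (w : V → ℝ) (i : V) :
    ∑ l, vvec r i l * w l = markovGen r w i := by
  simp only [vvec, markovGen, Finset.sum_mul]
  rw [Finset.sum_comm]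
  refine Finset.sum_congr rfl fun k _ => ?_
  simp [mul_assoc, sub_mul, ← Finset.mul_sum, Finset.sum_sub_distrib]

/-- The Green function of the chain killed on `S`, completed by the harmonic extensions of the
indicators on `S`. -/
lemma exists_green (hr : ∀ i j, 0 ≤ r i j) (hirr : IrreducibleRates r)
    {S : Finset V} (hS : S.Nonempty) :
    ∃ G : V → V → ℝ, (∀ i j, 0 ≤ G i j) ∧
      (∀ i ∈ S, ∀ v, G i v = if i = v then 1 else 0) ∧
      (∀ i, i ∉ S → ∀ v, markovGen r (fun k => G k v) i = -(if i = v then 1 else 0)) ∧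
      (∀ (u : V → ℝ) (j : V), u j = (if j ∈ S then 1 else ∑ l, r j l) * ∑ k, u k * G k j -
        ∑ v ∈ Sᶜ, r v j * ∑ k, u k * G k v) := by
  let M : Matrix V V ℝ := fun i j =>
    (if i = j then (if i ∈ S then 1 else ∑ l, r i l) else 0) - (if i ∈ S then 0 else r i j)
  have hMS : ∀ (w : V → ℝ), ∀ i ∈ S, M.mulVec w i = w i := by
    intro w i hi
    simp [M, Matrix.mulVec, dotProduct, hi]
  have hMn : ∀ (w : V → ℝ), ∀ i, i ∉ S → M.mulVec w i = -markovGen r w i := by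
    intro w i hi
    simp [M, Matrix.mulVec, dotProduct, hi, markovGen, sub_mul, mul_sub, Finset.sum_sub_distrib,
      Finset.sum_mul]
  have hinj : Function.Injective M.mulVec := by
    rw [← Matrix.coe_mulVecLin, injective_iff_map_eq_zero]
    intro w hw
    rw [Matrix.mulVecLin_apply] at hw
    funext i
    refine eq_zero_of_harmonic hr hirr hS (fun i hi => ?_) (fun i hi => ?_) i
    · rw [← hMS w i hi, hw]; rfl
    · have := hMn w i hi
      rw [hw, Pi.zero_apply] at this
      linarith
  have hunit : IsUnit M := Matrix.mulVec_injective_iff_isUnit.1 hinj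
  have hdet : IsUnit M.det := (Matrix.isUnit_iff_isUnit_det M).1 hunit
  obtain ⟨N, hMN, hNM⟩ : ∃ N : Matrix V V ℝ, M * N = 1 ∧ N * M = 1 :=
    ⟨M⁻¹, Matrix.mul_nonsing_inv M hdet, Matrix.nonsing_inv_mul M hdet⟩
  have hMG : ∀ i v, M.mulVec (fun k => N k v) i = if i = v then 1 else 0 := by
    intro i v
    have := congrFun (congrFun hMN i) v
    rwa [Matrix.mul_apply, Matrix.one_apply] at this
  have hGS : ∀ i ∈ S, ∀ v, N i v = if i = v then 1 else 0 := fun i hi v => by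
    rw [← hMG i v, hMS _ i hi]
  have hGn : ∀ i, i ∉ S → ∀ v,
      markovGen r (fun k => N k v) i = -(if i = v then 1 else 0) := fun i hi v => by
    rw [← hMG i v, hMn _ i hi, neg_neg]
  refine ⟨fun i j => N i j, fun i j => ?_, hGS, hGn, fun u j => ?_⟩
  · refine nonneg_of_superharmonic hr hirr hS (w := fun k => N k j) (fun i hi => ?_)
      (fun i hi => ?_) i
    · rw [hGS i hi]; split_ifs <;> norm_num
    · rw [hGn i hi]; split_ifs <;> norm_num
  · have h : Matrix.vecMul (Matrix.vecMul u N) M = u := by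
      rw [Matrix.vecMul_vecMul, hNM, Matrix.vecMul_one]
    have hj := congrFun h j
    have hy : ∀ v, Matrix.vecMul u N v = ∑ k, u k * N k v := fun v => rfl
    conv_lhs => rw [← hj]
    rw [Matrix.vecMul, dotProduct]
    simp only [hy, M, mul_sub, Finset.sum_sub_distrib]
    congr 1
    · simp [mul_comm]
    · rw [← Finset.sum_add_sum_compl S, Finset.sum_eq_zero (s := S) (fun i hi => by simp [hi]),
        zero_add]
      refine Finset.sum_congr rfl fun i hi => ?_
      rw [if_neg (Finset.mem_compl.1 hi), mul_comm]

/-- `λ^A(j) = ⟨λ, 1^A_j⟩`. -/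
lemma lamA_eq_sum_lamV_mul (hr : ∀ i j, 0 ≤ r i j) (hirr : IrreducibleRates r)
    {ind : Finset V → V → V → ℝ} (hind : IsHarmFamily r ind) {A : Finset V} {j : V}
    (hj : j ∈ A) : lamA r ind A j = ∑ k, lamV r k * ind A j k := by
  have hharm : ∀ i ∈ A, ∀ k, k ∉ A → markovGen r (ind A i) k = 0 := fun i hi => (hind A i hi).2
  have hrate : ∀ i ∈ A, ∀ l ∈ A, i ≠ l →
      traceRate r ind A i l = ∑ k, r i k * ind A l k := by
    intro i hi l hl hil
    rw [traceRate, if_neg hil, ← Finset.sum_add_sum_compl A]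
    congr 1
    rw [Finset.sum_congr rfl fun k hk => by rw [(hind A l hl).1 k hk]]
    simp [hl]
  have hpart : ∀ k, ∑ i ∈ A, ind A i k = 1 := by
    intro k
    have h := eq_zero_of_harmonic hr hirr ⟨j, hj⟩ (w := fun k => ∑ i ∈ A, ind A i k - 1)
      (fun k hk => by
        rw [Finset.sum_congr rfl fun i hi => (hind A i hi).1 k hk]
        simp [hk])
      (fun k hk => by
        have h0 : ∑ i ∈ A, markovGen r (ind A i) k = 0 :=
          Finset.sum_eq_zero fun i hi => hharm i hi k hk
        rw [← h0]
        simp only [markovGen]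
        rw [Finset.sum_comm]
        refine Finset.sum_congr rfl fun l _ => ?_
        rw [← Finset.mul_sum, Finset.sum_sub_distrib]
        ring) k
    linarith
  have hself : ind A j j = 1 := by rw [(hind A j hj).1 j hj, if_pos rfl]
  have hin : ∑ i ∈ A.erase j, traceRate r ind A i j =
      ∑ i ∈ A.erase j, markovGen r (ind A j) i := by
    refine Finset.sum_congr rfl fun i hi => ?_
    obtain ⟨hij, hiA⟩ := Finset.mem_erase.1 hi
    rw [hrate i hiA j hj hij, markovGen, (hind A j hj).1 i hiA, if_neg hij]
    simp
  have hout : ∑ i ∈ A.erase j, traceRate r ind A j i = -markovGen r (ind A j) j := by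
    rw [Finset.sum_congr rfl fun i hi => hrate j hj i (Finset.mem_erase.1 hi).2
      (Finset.mem_erase.1 hi).1.symm, Finset.sum_comm, markovGen, ← Finset.sum_neg_distrib]
    refine Finset.sum_congr rfl fun k _ => ?_
    have := hpart k
    rw [← Finset.add_sum_erase A _ hj] at this
    rw [← Finset.mul_sum, hself, eq_sub_of_add_eq' this]
    ring
  rw [sum_lamV_mul, ← Finset.sum_add_sum_compl A,
    Finset.sum_eq_zero (s := Aᶜ) fun i hi => hharm j hj i (Finset.mem_compl.1 hi), add_zero,
    ← Finset.add_sum_erase A _ hj, lamA, ← Finset.add_sum_erase A _ hj, Finset.sum_sub_distrib,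
    hin, hout]
  ring

/-- Along a column of the Green function killed on an absorbing set, the drift is nonpositive. -/
lemma sum_lamV_mul_green_nonpos (hr : ∀ i j, 0 ≤ r i j) (hirr : IrreducibleRates r)
    {ind : Finset V → V → V → ℝ} (hind : IsHarmFamily r ind) {S : Finset V} (hS : S.Nonempty)
    {j : V} (hj : j ∉ S) (habs : lamA r ind (insert j S) j ≤ 0) {g : V → ℝ} (hg : 0 ≤ g j)
    (hgS : ∀ i ∈ S, g i = 0)
    (hgL : ∀ i, i ∉ S → markovGen r g i = -(if i = j then 1 else 0)) :
    ∑ k, lamV r k * g k ≤ 0 := by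
  have hjA : j ∈ insert j S := Finset.mem_insert_self j S
  obtain ⟨hA, hL⟩ := hind (insert j S) j hjA
  have hlam := lamA_eq_sum_lamV_mul hr hirr hind hjA
  generalize ind (insert j S) j = w at hA hL hlam
  obtain ⟨c, hc⟩ : ∃ c, c = -markovGen r w j := ⟨_, rfl⟩
  have heq : ∀ k, w k - c * g k = 0 := by
    refine eq_zero_of_harmonic hr hirr hS (fun i hi => ?_) (fun i hi => ?_)
    · rw [hA i (Finset.mem_insert_of_mem hi), hgS i hi, if_neg (fun h : i = j => hj (h ▸ hi))]
      simp
    · rw [markovGen_sub_smul, hgL i hi]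
      by_cases hij : i = j
      · subst hij
        rw [if_pos rfl, hc]; ring
      · have h0 : markovGen r w i = 0 := hL i (by simp [hij, hi])
        rw [if_neg hij, h0]; ring
  have hcpos : 0 < c := by
    have h1 := heq j
    rw [hA j hjA, if_pos rfl] at h1
    by_contra! hneg
    nlinarith
  have hsum : ∑ k, lamV r k * w k = c * ∑ k, lamV r k * g k := by
    rw [Finset.mul_sum]
    refine Finset.sum_congr rfl fun k _ => ?_
    rw [show w k = c * g k by linarith [heq k]]
    ring
  by_contra! hpos
  have := mul_pos hcpos hpos
  linarith

end Generator

section TestFunction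

variable {V : Type*} [Fintype V] [DecidableEq V] {r : V → V → ℝ}

lemma memD_plateau {S : Finset V} {G : V → V → ℝ}
    (hGL : ∀ i, i ∉ S → ∀ v, markovGen r (fun k => G k v) i = -(if i = v then 1 else 0))
    {α β : V → ℝ}
    (hface : ∀ u ∈ stdSimplex ℝ V, (∀ v, α v + β v * ∑ k, u k * G k v < 1) →
      ∀ i, u i = 0 → i ∉ S ∧ α i + β i * ∑ k, u k * G k i ≤ 0) :
    MemD r univ (plateau α β G) := by
  refine ⟨⟨Set.univ, isOpen_univ, Set.subset_univ _, (contDiff_plateau α β G).contDiffOn⟩, ?_⟩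
  intro i _ u hu hui
  rw [fderiv_plateau]
  rcases le_or_gt 1 (∑ v, posSq (α v + β v * ∑ k, u k * G k v)) with h | h
  · rw [max_eq_right (by linarith)]
    ring
  · obtain ⟨hiS, hi⟩ := hface u hu (fun v => lt_one_of_posSq_lt_one <| lt_of_le_of_lt
      (Finset.single_le_sum (f := fun v => posSq (α v + β v * ∑ k, u k * G k v))
        (fun v _ => posSq_nonneg _) (mem_univ v)) h) i hui
    refine mul_eq_zero_of_right _ (Finset.sum_eq_zero fun v _ => ?_)
    rw [sum_vvec_mul r (fun k => G k v) i, hGL i hiS v]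
    by_cases hiv : i = v
    · subst hiv
      rw [max_eq_right hi]
      ring
    · simp [hiv]

/-- If `y` solves the dual Green equation with right-hand side `u` and is close to its threshold,
then `u` can vanish only at coordinates outside `S` where `y` is below the threshold `s • Y`. -/
lemma notMem_and_le_of_eq_zero (hr : ∀ i j, 0 ≤ r i j) {S : Finset V} {u y Y : V → ℝ}
    {δ s η : ℝ} (hs : 0 < s) (hη : 0 < η)
    (hu : ∀ j, u j = (if j ∈ S then 1 else ∑ l, r j l) * y j - ∑ v ∈ Sᶜ, r v j * y v)
    (hY : ∀ j, 1 = (if j ∈ S then 1 else ∑ l, r j l) * Y j - ∑ v ∈ Sᶜ, r v j * Y v)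
    (hηY : ∀ j, j ∉ S → η * ((∑ l, r j l) * Y j) ≤ 1)
    (hsδ : ∀ i ∈ S, s * (1 + η) * ∑ v ∈ Sᶜ, r v i * Y v ≤ δ / 2)
    (hyS : ∀ i ∈ S, δ / 2 < y i) (hyn : ∀ j, j ∉ S → y j ≤ s * (1 + η) * Y j)
    (i : V) (hi : u i = 0) : i ∉ S ∧ y i ≤ s * Y i := by
  have hsum : ∑ v ∈ Sᶜ, r v i * y v ≤ s * (1 + η) * ∑ v ∈ Sᶜ, r v i * Y v := by
    rw [Finset.mul_sum]
    refine Finset.sum_le_sum fun v hv => ?_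
    have := mul_le_mul_of_nonneg_left (hyn v (Finset.mem_compl.1 hv)) (hr v i)
    linarith
  have hui := hu i
  have hYi := hY i
  rw [hi] at hui
  by_cases hiS : i ∈ S
  · rw [if_pos hiS] at hui
    linarith [hyS i hiS, hsδ i hiS]
  · refine ⟨hiS, ?_⟩
    rw [if_neg hiS] at hui hYi
    by_contra! hlt
    have hd : 0 ≤ ∑ l, r i l := Finset.sum_nonneg fun l _ => hr i l
    have h1 := mul_le_mul_of_nonneg_left hlt.le hd
    have h2 : ∑ v ∈ Sᶜ, r v i * Y v = (∑ l, r i l) * Y i - 1 := by linarith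
    rw [h2] at hsum
    have h3 := mul_le_mul_of_nonneg_left (hηY i hiS) hs.le
    have h4 := mul_pos hs hη
    nlinarith

end TestFunction

lemma exists_pos_lower_bound {V : Type*} [Fintype V] {ζ : ℝ → V → ℝ} (hζ : IsPath ζ)
    {S : Finset V} {t : ℝ} (hne : ∀ s : ℝ, 0 ≤ s → s ≤ t → ∀ i ∈ S, ζ s i ≠ 0) :
    ∃ δ : ℝ, 0 < δ ∧ ∀ s : ℝ, 0 ≤ s → s ≤ t → ∀ i ∈ S, δ ≤ ζ s i := by
  have hpt : ∀ i ∈ S, ∃ δ : ℝ, 0 < δ ∧ ∀ s ∈ Set.Icc 0 t, δ ≤ ζ s i := by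
    intro i hi
    have hcont : ContinuousOn (fun s => ζ s i) (Set.Icc 0 t) :=
      ((continuous_apply i).comp_continuousOn hζ.1).mono Set.Icc_subset_Ici_self
    refine isCompact_Icc.exists_forall_le' hcont fun s hs => ?_
    exact lt_of_le_of_ne ((hζ.2 s hs.1).1 i) (hne s hs.1 hs.2 i hi).symm
  choose! δ hδ hle using hpt
  rcases S.eq_empty_or_nonempty with rfl | hS
  · exact ⟨1, one_pos, by simp⟩
  · obtain ⟨i₀, hi₀, hmin⟩ := Finset.exists_min_image S δ hS
    exact ⟨δ i₀, hδ i₀ hi₀, fun s h0 hst i hi => (hmin i hi).trans (hle i hi s ⟨h0, hst⟩)⟩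

/-- if `ζ` satisfies condition (A) and `S = 𝒮(ζ_0)` is `r`-absorbing, then the
coordinates outside `S` vanish on `[0,T)`, where `T = inf{t ≥ 0 : ζ_t(i) = 0 for some i ∈ S}`.
(`t ∈ [0,T)` is expressed by: no `s ∈ [0,t]` has a vanishing `S`-coordinate.) -/
theorem vanishing_outside_support (V : Type*) [Fintype V] [DecidableEq V] [Nonempty V]
    (r : V → V → ℝ) (hr_nonneg : ∀ i j, 0 ≤ r i j) (hr_diag : ∀ i, r i i = 0)
    (hr_irr : IrreducibleRates r)
    (ind : Finset V → V → V → ℝ) (hind : IsHarmFamily r ind)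
    (ζ : ℝ → V → ℝ) (hζ : IsPath ζ) (hζA : CondA r ζ)
    (hS : IsAbsorbing r ind (suppF (ζ 0))) :
    ∀ t : ℝ, 0 ≤ t →
      (∀ s : ℝ, 0 ≤ s → s ≤ t → ∀ i ∈ suppF (ζ 0), ζ s i ≠ 0) →
      ∀ j, j ∉ suppF (ζ 0) → ζ t j = 0 := by
  intro t ht hne j hj
  set S := suppF (ζ 0) with hSdef
  have hout : ∀ i, i ∉ S → ζ 0 i = 0 := fun i hi => by
    refine le_antisymm ?_ ((hζ.2 0 le_rfl).1 i)
    simpa [hSdef, suppF] using hi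
  have hSne : S.Nonempty := by
    by_contra hemp
    rw [Finset.not_nonempty_iff_eq_empty] at hemp
    have := (hζ.2 0 le_rfl).2
    rw [Finset.sum_eq_zero fun i _ => hout i (by simp [hemp])] at this
    exact zero_ne_one this
  have habs : ∀ i, i ∉ S → lamA r ind (insert i S) i ≤ 0 :=
    hS.resolve_left fun h => hj (h ▸ mem_univ j)
  obtain ⟨δ, hδ, hδle⟩ := exists_pos_lower_bound hζ hne
  obtain ⟨G, hG0, hGS, hGL, hGu⟩ := exists_green hr_nonneg hr_irr hSne
  have hdrift : ∀ v, v ∉ S → ∑ k, lamV r k * G k v ≤ 0 := fun v hv =>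
    sum_lamV_mul_green_nonpos hr_nonneg hr_irr hind hSne hv (habs v hv) (hG0 v v)
      (fun i hi => by rw [hGS i hi, if_neg fun h : i = v => hv (h ▸ hi)])
      (fun i hi => hGL i hi v)
  have hy0 : ∀ u ∈ stdSimplex ℝ V, ∀ v, 0 ≤ ∑ k, u k * G k v := fun u hu v =>
    Finset.sum_nonneg fun k _ => mul_nonneg (hu.1 k) (hG0 k v)
  have hyS : ∀ u ∈ stdSimplex ℝ V, ∀ i ∈ S, u i ≤ ∑ k, u k * G k i := by
    intro u hu i hi
    have h := hGu u i
    rw [if_pos hi] at h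
    have : 0 ≤ ∑ v ∈ Sᶜ, r v i * ∑ k, u k * G k v :=
      Finset.sum_nonneg fun v _ => mul_nonneg (hr_nonneg v i) (hy0 u hu v)
    linarith
  obtain ⟨Y, hYdef⟩ : ∃ Y : V → ℝ, ∀ v, ∑ k, (1 : ℝ) * G k v = Y v := ⟨_, fun _ => rfl⟩
  have hY : ∀ j, 1 = (if j ∈ S then 1 else ∑ l, r j l) * Y j - ∑ v ∈ Sᶜ, r v j * Y v := by
    simpa only [hYdef] using hGu fun _ => 1
  have hY0 : ∀ v, 0 ≤ Y v := fun v => by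
    rw [← hYdef]
    exact Finset.sum_nonneg fun k _ => mul_nonneg zero_le_one (hG0 k v)
  have hd0 : ∀ v, 0 ≤ ∑ l, r v l := fun v => Finset.sum_nonneg fun l _ => hr_nonneg v l
  have hin0 : ∀ i, 0 ≤ ∑ v ∈ Sᶜ, r v i * Y v := fun i =>
    Finset.sum_nonneg fun v _ => mul_nonneg (hr_nonneg v i) (hY0 v)
  have hYpos : ∀ v, v ∉ S → 0 < Y v := fun v hv => by
    refine lt_of_le_of_ne (hY0 v) fun h => ?_
    have := hY v
    rw [← h, mul_zero] at this
    linarith [hin0 v]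
  obtain ⟨η, hη, hηY⟩ : ∃ η : ℝ, 0 < η ∧ ∀ v, η * ((∑ l, r v l) * Y v) ≤ 1 := by
    have hnn : ∀ v ∈ univ, 0 ≤ (∑ l, r v l) * Y v := fun v _ => mul_nonneg (hd0 v) (hY0 v)
    have hpos : 0 < 1 + ∑ v, (∑ l, r v l) * Y v := by
      linarith [Finset.sum_nonneg hnn]
    refine ⟨(1 + ∑ v, (∑ l, r v l) * Y v)⁻¹, inv_pos.2 hpos, fun v => ?_⟩
    rw [inv_mul_le_one₀ hpos]
    linarith [Finset.single_le_sum hnn (mem_univ v)]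
  obtain ⟨s₀, hs₀, hs₀δ⟩ : ∃ s₀ : ℝ, 0 < s₀ ∧
      ∀ i, s₀ * (1 + η) * ∑ v ∈ Sᶜ, r v i * Y v ≤ δ / 2 := by
    have hpos : 0 < 1 + ∑ i, ∑ v ∈ Sᶜ, r v i * Y v := by
      linarith [Finset.sum_nonneg fun i (_ : i ∈ univ) => hin0 i]
    refine ⟨δ / 2 / ((1 + η) * (1 + ∑ i, ∑ v ∈ Sᶜ, r v i * Y v)), by positivity, fun i => ?_⟩
    have hle := Finset.single_le_sum (fun i _ => hin0 i) (mem_univ i)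
    rw [div_mul_eq_mul_div, div_mul_eq_mul_div, div_le_iff₀ (by positivity)]
    have := mul_le_mul_of_nonneg_left (hle.trans (le_add_of_nonneg_left zero_le_one))
      (by positivity : 0 ≤ δ / 2 * (1 + η))
    linarith
  have hbound : ∀ s, 0 < s → s ≤ s₀ → ∀ v, v ∉ S → ∑ k, ζ t k * G k v ≤ s * Y v := by
    intro s hs hss₀
    let α : V → ℝ := fun v => if v ∈ S then 2 else -1 / η
    let β : V → ℝ := fun v => if v ∈ S then -2 / δ else 1 / (s * η * Y v)
    have hαβS : ∀ v ∈ S, ∀ x : ℝ, α v + β v * x = 2 * (δ - x) / δ := by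
      intro v hv x
      simp only [α, β, if_pos hv]
      field_simp
      ring
    have hαβn : ∀ v, v ∉ S → ∀ x : ℝ, α v + β v * x = (x - s * Y v) / (s * η * Y v) := by
      intro v hv x
      have := (hYpos v hv).ne'
      simp only [α, β, if_neg hv]
      field_simp
      ring
    have hden : ∀ v, v ∉ S → 0 < s * η * Y v := fun v hv => mul_pos (mul_pos hs hη) (hYpos v hv)
    have hmem : MemD r univ (plateau α β G) := by
      refine memD_plateau hGL fun u hu hlt i hi => ?_
      have key := notMem_and_le_of_eq_zero hr_nonneg hs hη (hGu u) hY (fun v _ => hηY v)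
        (δ := δ) (fun i _ => le_trans (mul_le_mul_of_nonneg_right
          (mul_le_mul_of_nonneg_right hss₀ (by positivity)) (hin0 i)) (hs₀δ i))
        (fun v hv => by
          have := hlt v
          rw [hαβS v hv, div_lt_one hδ] at this
          linarith)
        (fun v hv => by
          have := hlt v
          rw [hαβn v hv, div_lt_one (hden v hv)] at this
          linarith) i hi
      refine ⟨key.1, ?_⟩
      rw [hαβn i key.1]
      exact div_nonpos_of_nonpos_of_nonneg (by linarith [key.2]) (hden i key.1).le
    have hlS : ∀ τ, 0 ≤ τ → τ ≤ t → ∀ v ∈ S, α v + β v * ∑ k, ζ τ k * G k v ≤ 0 := by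
      intro τ h0 hτ v hv
      rw [hαβS v hv]
      exact div_nonpos_of_nonpos_of_nonneg
        (by linarith [hyS _ (hζ.2 τ h0) v hv, hδle τ h0 hτ v hv]) hδ.le
    have hint : ∫ τ in (0:ℝ)..t, fderiv ℝ (plateau α β G) (ζ τ) (lamV r) ≤ 0 := by
      have := intervalIntegral.integral_nonneg (μ := MeasureTheory.volume) ht
        (f := fun τ => -fderiv ℝ (plateau α β G) (ζ τ) (lamV r)) fun τ hτ => by
          rw [neg_nonneg, fderiv_plateau]
          refine mul_nonpos_of_nonneg_of_nonpos (by positivity) (Finset.sum_nonpos fun v _ => ?_)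
          by_cases hv : v ∈ S
          · rw [max_eq_right (hlS τ hτ.1 hτ.2 v hv)]
            simp
          · refine mul_nonpos_of_nonneg_of_nonpos (by positivity)
              (mul_nonpos_of_nonneg_of_nonpos ?_ (hdrift v hv))
            simp only [β, if_neg hv]
            exact (one_div_pos.2 (hden v hv)).le
      rw [intervalIntegral.integral_neg] at this
      linarith
    have hstart : plateau α β G (ζ 0) = -1 := by
      rw [plateau, Finset.sum_eq_zero]
      · simp [posSq]
      · intro v _
        refine posSq_of_nonpos ?_
        by_cases hv : v ∈ S
        · exact hlS 0 le_rfl ht v hv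
        · rw [Finset.sum_eq_zero, mul_zero, add_zero]
          · simp only [α, if_neg hv]
            exact div_nonpos_of_nonpos_of_nonneg (by norm_num) hη.le
          · intro k _
            by_cases hk : k ∈ S
            · rw [hGS k hk, if_neg fun h : k = v => hv (h ▸ hk), mul_zero]
            · rw [hout k hk, zero_mul]
    have hend := hζA _ hmem t ht
    rw [hstart, plateau] at hend
    intro v hv
    have hsum : ∑ v, posSq (α v + β v * ∑ k, ζ t k * G k v) ≤ 0 := by
      by_contra! hpos
      have h1 : posSq (1 - ∑ v, posSq (α v + β v * ∑ k, ζ t k * G k v)) < 1 := by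
        rw [posSq, sq_lt_one_iff₀ (le_max_right _ _)]
        exact max_lt (by linarith) one_pos
      linarith
    have hv' := nonpos_of_posSq_nonpos <| (Finset.single_le_sum
      (f := fun v => posSq (α v + β v * ∑ k, ζ t k * G k v))
      (fun v _ => posSq_nonneg _) (mem_univ v)).trans hsum
    rw [hαβn v hv, div_le_iff₀ (hden v hv)] at hv'
    linarith
  have hmemt := hζ.2 t ht
  have hyj : ∑ k, ζ t k * G k j ≤ 0 := by
    by_contra! hpos
    have hYj := hYpos j hj
    have h := hbound (min s₀ ((∑ k, ζ t k * G k j) / (2 * Y j))) (lt_min hs₀ (by positivity))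
      (min_le_left _ _) j hj
    have h' := h.trans (mul_le_mul_of_nonneg_right (min_le_right _ _) hYj.le)
    rw [div_mul_eq_mul_div, le_div_iff₀ (by positivity)] at h'
    nlinarith
  refine le_antisymm ?_ (hmemt.1 j)
  rw [hGu (ζ t) j, if_neg hj]
  have h1 := mul_nonpos_of_nonneg_of_nonpos (hd0 j) hyj
  have h2 : 0 ≤ ∑ v ∈ Sᶜ, r v j * ∑ k, ζ t k * G k v :=
    Finset.sum_nonneg fun v _ => mul_nonneg (hr_nonneg v j) (hy0 _ hmemt v)
  linarith
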